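/- arXiv:1405.3475 — 6 statements merged into one kernel-verified Lean document; each statement's English description precedes it below -/
import Mathlib

section
/- Let k ≥ 2 and let d_1 = 1, d_2 ≥ 2, …, d_{k−1} ≥ 2, d_k ≥ 1 be integers, and let g_0,…,g_k be the associated polynomials. Then for every i with 1 ≤ i ≤ k−1, the polynomial g_i(λ) + g_{i−1}(λ) is divisible by λ + 2. -/
open Polynomial

/-- The polynomials `g_0, g_1, …, g_k` associated with the sequence `d 1, …, d k`:
`g_0 = 1`, `g_1 = λ + 1`,
`g_i = (λ + 2 - d_i)·g_{i-1} - (d_i - 1)·g_{i-2}` for `2 ≤ i ≤ k - 1`, and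
`g_k = (λ + 2 - d_k)·g_{k-1} - d_k·g_{k-2}`. -/
noncomputable def gPoly (d : ℕ → ℕ) (k : ℕ) : ℕ → Polynomial ℝ
  | 0 => 1
  | 1 => X + 1
  | (i + 2) =>
    if i + 2 < k then
      (X + C (2 - (d (i + 2) : ℝ))) * gPoly d k (i + 1) - C ((d (i + 2) : ℝ) - 1) * gPoly d k i
    else if i + 2 = k then
      (X + C (2 - (d k : ℝ))) * gPoly d k (i + 1) - C (d k : ℝ) * gPoly d k i
    else 0

/-- For `1 ≤ i ≤ k - 1`, the polynomial `g_i + g_{i-1}` is divisible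
by `λ + 2`. -/
theorem gPoly_add_dvd (k : ℕ) (hk : 2 ≤ k) (d : ℕ → ℕ) (hd1 : d 1 = 1)
    (hd : ∀ i, 2 ≤ i → i ≤ k - 1 → 2 ≤ d i) (hdk : 1 ≤ d k) :
    ∀ i, 1 ≤ i → i ≤ k - 1 → (X + 2 : Polynomial ℝ) ∣ (gPoly d k i + gPoly d k (i - 1)) := by
  intro i hi
  induction i, hi using Nat.le_induction with
  | base =>
    intro _
    simp only [gPoly, Nat.sub_self]
    exact ⟨1, by ring⟩
  | succ n hn ih =>
    intro hnk
    obtain ⟨m, rfl⟩ := Nat.exists_eq_add_of_le' hn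
    have hrec : gPoly d k (m + 1 + 1) + gPoly d k (m + 1) =
        (X + 2) * gPoly d k (m + 1)
          - C ((d (m + 2) : ℝ) - 1) * (gPoly d k (m + 1) + gPoly d k m) := by
      rw [gPoly, if_pos (by omega)]
      simp only [map_sub, map_ofNat, map_one]
      ring
    rw [Nat.add_sub_cancel, hrec]
    exact dvd_sub (dvd_mul_right _ _) ((ih (by omega)).mul_left _)
end

section
/- Let k ≥ 2 and let d_1 = 1, d_2 ≥ 2, …, d_{k−1} ≥ 2, d_k ≥ 1 be integers, and let g_0,…,g_k be the associated polynomials. Then the polynomial g_k(λ) is divisible by λ + 2. -/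
open Polynomial

/-- At `λ = -2` consecutive polynomials below the top index cancel. -/
theorem eval_gPoly_add_eval_gPoly_succ (d : ℕ → ℕ) (k i : ℕ) (hi : i + 1 < k) :
    (gPoly d k i).eval (-2) + (gPoly d k (i + 1)).eval (-2) = 0 := by
  induction i with
  | zero => norm_num [gPoly]
  | succ i ih =>
    have h := ih (by omega)
    rw [gPoly, if_pos hi]
    simp only [eval_sub, eval_mul, eval_add, eval_X, eval_C]
    linear_combination (1 - (d (i + 2) : ℝ)) * h

/-- The polynomial `g_k` is divisible by `λ + 2`. -/
theorem gPoly_top_dvd (k : ℕ) (hk : 2 ≤ k) (d : ℕ → ℕ) (hd1 : d 1 = 1)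
    (hd : ∀ i, 2 ≤ i → i ≤ k - 1 → 2 ≤ d i) (hdk : 1 ≤ d k) :
    (X + 2 : Polynomial ℝ) ∣ gPoly d k k := by
  have hX : (X + 2 : Polynomial ℝ) = X - C (-2) := by
    rw [C_neg, sub_neg_eq_add, C_ofNat]
  rw [hX, dvd_iff_isRoot, IsRoot.def]
  obtain ⟨i, rfl⟩ := Nat.exists_eq_add_of_le' hk
  have h := eval_gPoly_add_eval_gPoly_succ d (i + 2) i (by omega)
  rw [gPoly, if_neg (lt_irrefl _), if_pos rfl]
  simp only [eval_sub, eval_mul, eval_add, eval_X, eval_C]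
  linear_combination (-(d (i + 2) : ℝ)) * h
end

section
/- Let k ≥ 2 and let d_1 = 1, d_2 ≥ 2, …, d_{k−1} ≥ 2, d_k ≥ 1 be integers, and let g_0,…,g_k be the associated polynomials. Then for every i with 1 ≤ i ≤ k, every real zero of the polynomial g_i(λ) is a simple zero. -/
open Polynomial

/-- Each `gPoly d k (i + 2)` comes from a three-term recurrence with positive last coefficient. -/
lemma gPoly_exists_recurrence {k : ℕ} {d : ℕ → ℕ}
    (hd : ∀ i, 2 ≤ i → i ≤ k - 1 → 2 ≤ d i) (hdk : 1 ≤ d k) {i : ℕ} (hi : i + 2 ≤ k) :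
    ∃ a b : ℝ, 0 < b ∧
      gPoly d k (i + 2) = (X + C a) * gPoly d k (i + 1) - C b * gPoly d k i := by
  rcases hi.lt_or_eq with h | h
  · have h2 : (2 : ℝ) ≤ d (i + 2) := by exact_mod_cast hd (i + 2) (by omega) (by omega)
    exact ⟨2 - (d (i + 2) : ℝ), (d (i + 2) : ℝ) - 1, by linarith, by rw [gPoly, if_pos h]⟩
  · exact ⟨2 - (d k : ℝ), d k, by exact_mod_cast hdk, by rw [gPoly, if_neg h.not_lt, if_pos h]⟩

/-- The Wronskian of two consecutive polynomials `gPoly d k i`, `gPoly d k (i + 1)` is positive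
on the real line. -/
lemma gPoly_wronskian_pos {k : ℕ} {d : ℕ → ℕ}
    (hd : ∀ i, 2 ≤ i → i ≤ k - 1 → 2 ≤ d i) (hdk : 1 ≤ d k) (x : ℝ) (i : ℕ) (hi : i + 1 ≤ k) :
    0 < (wronskian (gPoly d k i) (gPoly d k (i + 1))).eval x := by
  induction i with
  | zero => simp [gPoly, wronskian]
  | succ i ih =>
    obtain ⟨a, b, hb, h⟩ := gPoly_exists_recurrence hd hdk hi
    have hstep : wronskian (gPoly d k (i + 1)) (gPoly d k (i + 2)) =
        gPoly d k (i + 1) ^ 2 + C b * wronskian (gPoly d k i) (gPoly d k (i + 1)) := by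
      simp only [h, wronskian, derivative_sub, derivative_mul, derivative_add, derivative_X,
        derivative_C]
      ring
    rw [hstep, eval_add, eval_pow, eval_mul, eval_C]
    have := mul_pos hb (ih (by omega))
    positivity

/-- For `1 ≤ i ≤ k`, all real zeros of the polynomial `g_i` are simple. -/
theorem gPoly_roots_simple (k : ℕ) (hk : 2 ≤ k) (d : ℕ → ℕ) (hd1 : d 1 = 1)
    (hd : ∀ i, 2 ≤ i → i ≤ k - 1 → 2 ≤ d i) (hdk : 1 ≤ d k) :
    ∀ i, 1 ≤ i → i ≤ k → ∀ x : ℝ, (gPoly d k i).IsRoot x →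
      (gPoly d k i).rootMultiplicity x = 1 := by
  intro i hi hik x hx
  obtain ⟨j, rfl⟩ := Nat.exists_eq_add_of_le' hi
  have hw := gPoly_wronskian_pos hd hdk x j hik
  have hne : gPoly d k (j + 1) ≠ 0 := fun h => by simp [h] at hw
  refine le_antisymm (not_lt.mp fun h => ?_) ((rootMultiplicity_pos hne).mpr hx)
  have hder := ((one_lt_rootMultiplicity_iff_isRoot hne).mp h).2
  simp [wronskian, hx.eq_zero, IsRoot.eq_zero hder] at hw
end

section
/- Let k ≥ 2 and let d_1 = 1, d_2 ≥ 2, …, d_{k−1} ≥ 2, d_k ≥ 1 be integers, and let g_0,…,g_k be the associated polynomials. For i = 1,…,k let γ_i denote the smallest real zero of g_i, and let β denote the second smallest real zero of g_k. Then γ_1 > γ_2 > ⋯ > γ_k = −2 and β > γ_{k−1}. -/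
open Polynomial

/-- The values `(-1)^i g_i(x)`, which are positive to the left of all zeros of `g_i`. -/
noncomputable def signedEval (d : ℕ → ℕ) (k i : ℕ) (x : ℝ) : ℝ :=
  (-1) ^ i * (gPoly d k i).eval x

section signedEval

variable {d : ℕ → ℕ} {k : ℕ}

lemma signedEval_zero (x : ℝ) : signedEval d k 0 x = 1 := by
  simp [signedEval, gPoly]

lemma signedEval_one (x : ℝ) : signedEval d k 1 x = -x - 1 := by
  simp [signedEval, gPoly]
  ring

lemma signedEval_add_two {i : ℕ} (hi : i + 2 < k) (x : ℝ) :
    signedEval d k (i + 2) x =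
      (d (i + 2) - 2 - x) * signedEval d k (i + 1) x - (d (i + 2) - 1) * signedEval d k i x := by
  simp only [signedEval, gPoly, if_pos hi, eval_sub, eval_mul, eval_add, eval_X, eval_C]
  ring

lemma signedEval_last {i : ℕ} (hi : i + 2 = k) (x : ℝ) :
    signedEval d k (i + 2) x =
      (d k - 2 - x) * signedEval d k (i + 1) x - d k * signedEval d k i x := by
  simp only [signedEval, gPoly, if_neg hi.not_lt, if_pos hi, eval_sub, eval_mul, eval_add,
    eval_X, eval_C]
  ring

lemma isRoot_gPoly_iff {i : ℕ} {x : ℝ} : (gPoly d k i).IsRoot x ↔ signedEval d k i x = 0 := by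
  simp [signedEval, IsRoot]

lemma continuous_signedEval (i : ℕ) : Continuous (signedEval d k i) :=
  continuous_const.mul (gPoly d k i).continuous

lemma one_le_signedEval (hd : ∀ i, 2 ≤ i → i < k → 2 ≤ d i) {x : ℝ} (hx : x ≤ -2) (i : ℕ)
    (hi : i + 1 < k) :
    1 ≤ signedEval d k i x ∧ signedEval d k i x ≤ signedEval d k (i + 1) x := by
  induction i with
  | zero => rw [signedEval_zero, signedEval_one]; constructor <;> linarith
  | succ i ih =>
    obtain ⟨h1, h2⟩ := ih (by omega)
    have hdi : (2 : ℝ) ≤ d (i + 2) := by exact_mod_cast hd (i + 2) (by omega) hi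
    refine ⟨h1.trans h2, ?_⟩
    rw [signedEval_add_two hi]
    nlinarith [mul_nonneg (sub_nonneg.2 hx) (zero_le_one.trans (h1.trans h2)),
      mul_nonneg (by linarith : (0 : ℝ) ≤ d (i + 2) - 1) (sub_nonneg.2 h2)]

lemma one_le_signedEval_of_lt (hd : ∀ i, 2 ≤ i → i < k → 2 ≤ d i) {x : ℝ} (hx : x ≤ -2) {i : ℕ}
    (hi : i < k) : 1 ≤ signedEval d k i x := by
  cases i with
  | zero => rw [signedEval_zero]
  | succ i =>
    obtain ⟨h1, h2⟩ := one_le_signedEval hd hx i hi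
    exact h1.trans h2

lemma signedEval_neg_two {i : ℕ} (hi : i < k) : signedEval d k i (-2) = 1 := by
  induction i using Nat.twoStepInduction with
  | zero => exact signedEval_zero _
  | one => rw [signedEval_one]; norm_num
  | more i ih1 ih2 =>
    rw [signedEval_add_two hi, ih1 (by omega), ih2 (by omega)]
    ring

lemma signedEval_last_neg_two (hk : 2 ≤ k) : signedEval d k k (-2) = 0 := by
  obtain ⟨i, rfl⟩ := Nat.exists_eq_add_of_le' hk
  rw [signedEval_last rfl, signedEval_neg_two (by omega), signedEval_neg_two (by omega)]
  ring

lemma signedEval_last_pos (hk : 2 ≤ k) (hd : ∀ i, 2 ≤ i → i < k → 2 ≤ d i) {x : ℝ}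
    (hx : x < -2) : 0 < signedEval d k k x := by
  obtain ⟨i, rfl⟩ := Nat.exists_eq_add_of_le' hk
  obtain ⟨h1, h2⟩ := one_le_signedEval hd hx.le i (by omega)
  rw [signedEval_last rfl]
  nlinarith [mul_pos (sub_pos.2 hx) (zero_lt_one.trans_le (h1.trans h2)),
    mul_nonneg (d (i + 2)).cast_nonneg (sub_nonneg.2 h2)]

lemma signedEval_succ_lt (hd : ∀ i, 2 ≤ i → i < k → 2 ≤ d i) {x : ℝ} (hx : -2 < x) (i : ℕ)
    (hi : i + 1 < k) (hpos : ∀ j ≤ i, 0 < signedEval d k j x) :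
    signedEval d k (i + 1) x < signedEval d k i x := by
  induction i with
  | zero => rw [signedEval_zero, signedEval_one]; linarith
  | succ i ih =>
    have h := ih (by omega) fun j hj => hpos j (by omega)
    have hdi : (2 : ℝ) ≤ d (i + 2) := by exact_mod_cast hd (i + 2) (by omega) hi
    rw [signedEval_add_two hi]
    nlinarith [mul_pos (sub_pos.2 hx) (hpos (i + 1) le_rfl),
      mul_pos (by linarith : (0 : ℝ) < d (i + 2) - 1) (sub_pos.2 h)]

lemma signedEval_last_neg (hk : 2 ≤ k) (hd : ∀ i, 2 ≤ i → i < k → 2 ≤ d i) (hdk : 1 ≤ d k)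
    {x : ℝ} (hx : -2 < x) (hpos : ∀ j, j + 1 < k → 0 < signedEval d k j x)
    (hnonneg : 0 ≤ signedEval d k (k - 1) x) : signedEval d k k x < 0 := by
  obtain ⟨i, rfl⟩ := Nat.exists_eq_add_of_le' hk
  have h := signedEval_succ_lt hd hx i (by omega) fun j hj => hpos j (by omega)
  have hdk' : (0 : ℝ) < d (i + 2) := by exact_mod_cast hdk
  rw [show i + 2 - 1 = i + 1 by omega] at hnonneg
  rw [signedEval_last rfl]
  nlinarith [mul_nonneg (sub_pos.2 hx).le hnonneg, mul_pos hdk' (sub_pos.2 h)]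

lemma exists_isRoot_of_signedEval_nonpos (hd : ∀ i, 2 ≤ i → i < k → 2 ≤ d i) {x : ℝ} {i : ℕ}
    (hi : i < k) (hx : signedEval d k i x ≤ 0) : ∃ y ≤ x, (gPoly d k i).IsRoot y := by
  have hx2 : -2 ≤ x := by
    by_contra! h
    linarith [one_le_signedEval_of_lt hd h.le hi]
  obtain ⟨y, hy, hy0⟩ := intermediate_value_Icc' hx2 (continuous_signedEval i).continuousOn
    ⟨hx, by rw [signedEval_neg_two hi]; exact zero_le_one⟩
  exact ⟨y, hy.2, isRoot_gPoly_iff.2 hy0⟩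

end signedEval

/-- Let `γ i` be the smallest real zero of `g_i` (`1 ≤ i ≤ k`), and let `β`
be the second smallest real zero of `g_k`.  Then `γ 1 > γ 2 > ⋯ > γ k = -2` and `β > γ (k-1)`. -/
theorem gPoly_smallest_zeros (k : ℕ) (hk : 2 ≤ k) (d : ℕ → ℕ) (hd1 : d 1 = 1)
    (hd : ∀ i, 2 ≤ i → i ≤ k - 1 → 2 ≤ d i) (hdk : 1 ≤ d k)
    (γ : ℕ → ℝ) (hγ : ∀ i, 1 ≤ i → i ≤ k → IsLeast {x : ℝ | (gPoly d k i).IsRoot x} (γ i))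
    (β : ℝ) (hβ : IsLeast {x : ℝ | (gPoly d k k).IsRoot x ∧ γ k < x} β) :
    (∀ i, 1 ≤ i → i + 1 ≤ k → γ (i + 1) < γ i) ∧ γ k = -2 ∧ γ (k - 1) < β := by
  have hd' : ∀ i, 2 ≤ i → i < k → 2 ≤ d i := fun i h2 hi => hd i h2 (by omega)
  have hroot : ∀ i, 1 ≤ i → i ≤ k → signedEval d k i (γ i) = 0 := fun i h1 hi =>
    isRoot_gPoly_iff.1 (hγ i h1 hi).1
  have hpos : ∀ i, 1 ≤ i → i < k → ∀ x < γ i, 0 < signedEval d k i x := by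
    intro i h1 hi x hx
    by_contra! h
    obtain ⟨y, hyx, hy⟩ := exists_isRoot_of_signedEval_nonpos hd' hi h
    exact absurd ((hγ i h1 hi.le).2 hy) (by linarith)
  have hgt : ∀ i, 1 ≤ i → i < k → -2 < γ i := by
    intro i h1 hi
    by_contra! h
    linarith [one_le_signedEval_of_lt hd' h hi, hroot i h1 hi.le]
  have hγk : γ k = -2 := by
    refine le_antisymm ((hγ k (by omega) le_rfl).2
      (isRoot_gPoly_iff.2 (signedEval_last_neg_two hk))) ?_
    by_contra! h
    linarith [signedEval_last_pos hk hd' h, hroot k (by omega) le_rfl]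
  have hstep : ∀ i, i + 2 < k → 0 < signedEval d k i (γ (i + 1)) → γ (i + 2) < γ (i + 1) := by
    intro i hi hprev
    have hdi : (2 : ℝ) ≤ d (i + 2) := by exact_mod_cast hd' (i + 2) (by omega) hi
    have hneg : signedEval d k (i + 2) (γ (i + 1)) < 0 := by
      rw [signedEval_add_two hi, hroot (i + 1) (by omega) (by omega)]
      nlinarith
    obtain ⟨y, hy, hy0⟩ := exists_isRoot_of_signedEval_nonpos hd' hi hneg.le
    refine lt_of_le_of_ne (((hγ (i + 2) (by omega) hi.le).2 hy0).trans hy) fun heq => ?_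
    rw [← heq, hroot (i + 2) (by omega) hi.le] at hneg
    exact hneg.false
  have hanti : ∀ i, i + 2 < k → γ (i + 2) < γ (i + 1) := by
    intro i
    induction i with
    | zero => exact fun hi => hstep 0 hi (by rw [signedEval_zero]; exact one_pos)
    | succ i ih =>
      exact fun hi => hstep (i + 1) hi (hpos (i + 1) (by omega) (by omega) _ (ih (by omega)))
  refine ⟨fun i h1 hi => ?_, hγk, ?_⟩
  · obtain ⟨i, rfl⟩ := Nat.exists_eq_add_of_le' h1
    rcases hi.lt_or_eq with hlt | heq
    · exact hanti i hlt
    · rw [heq, hγk]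
      exact hgt (i + 1) h1 (by omega)
  · by_contra! hle
    have hlast : ∀ n i, i + 1 + n + 1 = k → 1 ≤ i → γ (k - 1) < γ i := by
      intro n
      induction n with
      | zero =>
        intro i hi h1
        obtain ⟨j, rfl⟩ := Nat.exists_eq_add_of_le' h1
        rw [show k - 1 = j + 2 by omega]
        exact hanti j (by omega)
      | succ n ih =>
        intro i hi h1
        obtain ⟨j, rfl⟩ := Nat.exists_eq_add_of_le' h1
        exact (ih (j + 2) (by omega) (by omega)).trans (hanti j (by omega))
    have hβ0 := isRoot_gPoly_iff.1 hβ.1.1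
    refine (signedEval_last_neg hk hd' hdk (hγk ▸ hβ.1.2) (fun j hj => ?_) ?_).ne hβ0
    · rcases Nat.eq_zero_or_pos j with rfl | h1
      · rw [signedEval_zero]
        exact one_pos
      · exact hpos j h1 (by omega) β (hle.trans_lt (hlast (k - j - 2) j (by omega) h1))
    · rcases hle.lt_or_eq with hlt | heq
      · exact (hpos (k - 1) (by omega) (by omega) β hlt).le
      · rw [heq, hroot (k - 1) (by omega) (by omega)]
end

section
/- Let k ≥ 2 and let d_1 = 1, d_2 ≥ 2, …, d_k ≥ 2 be integers, and let g_0,…,g_k be the associated polynomials. Let γ be the smallest real zero of g_{k−1}. Then γ is not a zero of the polynomial g_k(λ)/(λ+2), and γ is not a zero of g_l for any l with 1 ≤ l ≤ k−2. -/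
open Polynomial

/-- A continuous function that is positive strictly to the left of `x` is nonnegative up to `x`. -/
theorem nonneg_of_pos_on_left {f : ℝ → ℝ} (hf : Continuous f) {x y : ℝ}
    (hpos : ∀ w < x, 0 < f w) (hyx : y ≤ x) : 0 ≤ f y := by
  have hsub : closure (Set.Iio x) ⊆ {w | 0 ≤ f w} :=
    closure_minimal (fun w hw => (hpos w hw).le) (isClosed_le continuous_const hf)
  rw [closure_Iio] at hsub
  exact hsub hyx

/-- A continuous function that is positive on a left ray and nonpositive at `y` has a first zero,
and this zero lies at or before `y`. -/
theorem exists_first_zero {f : ℝ → ℝ} (hf : Continuous f) {a y : ℝ} (ha : ∀ x ≤ a, 0 < f x)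
    (hy : f y ≤ 0) : ∃ z ≤ y, f z = 0 ∧ ∀ w < z, 0 < f w := by
  have hcompact : IsCompact (Set.Icc a y ∩ {w | f w ≤ 0}) :=
    isCompact_Icc.inter_right (isClosed_le hf continuous_const)
  have hay : a ≤ y := le_of_not_ge fun h => (ha y h).not_ge hy
  obtain ⟨z, ⟨⟨-, hzy⟩, hz⟩, hmin⟩ := hcompact.exists_isLeast ⟨y, ⟨hay, le_rfl⟩, hy⟩
  have hpos : ∀ w < z, 0 < f w := by
    intro w hw
    by_contra! hle
    have haw : a ≤ w := le_of_not_ge fun h => (ha w h).not_ge hle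
    exact hw.not_ge (hmin ⟨⟨haw, hw.le.trans hzy⟩, hle⟩)
  exact ⟨z, hzy, le_antisymm hz (nonneg_of_pos_on_left hf hpos le_rfl), hpos⟩

/-- In a Sturm-like sequence `h 0, …, h N` of continuous functions, positivity of `h (n + 1)`
strictly to the left of `x` gives positivity of `h n` up to and including `x`. -/
theorem sturm_pos_of_succ_pos {h : ℕ → ℝ → ℝ} {N : ℕ} {a : ℝ} (hcont : ∀ n, Continuous (h n))
    (hzero : ∀ x, 0 < h 0 x) (hleft : ∀ n ≤ N, ∀ x ≤ a, 0 < h n x)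
    (hroot : ∀ n, n + 2 ≤ N → ∀ z, h (n + 1) z = 0 → 0 < h n z → h (n + 2) z < 0) :
    ∀ n, n + 1 ≤ N → ∀ x, (∀ y < x, 0 < h (n + 1) y) → ∀ y ≤ x, 0 < h n y := by
  intro n
  induction n with
  | zero => exact fun _ _ _ y _ => hzero y
  | succ n ih =>
    intro hn x hx y hyx
    by_contra! hy
    obtain ⟨z, hzy, hz, hzpos⟩ := exists_first_zero (hcont (n + 1)) (hleft _ (by omega)) hy
    have hprev := ih (by omega) z hzpos z le_rfl
    exact (hroot n hn z hz hprev).not_ge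
      (nonneg_of_pos_on_left (hcont (n + 2)) hx (hzy.trans hyx))

theorem gPoly_add_two_eval {k i : ℕ} (d : ℕ → ℕ) (hi : i + 2 < k) (x : ℝ) :
    (gPoly d k (i + 2)).eval x = (x + (2 - (d (i + 2) : ℝ))) * (gPoly d k (i + 1)).eval x
      - ((d (i + 2) : ℝ) - 1) * (gPoly d k i).eval x := by
  rw [gPoly, if_pos hi]
  simp

theorem gPoly_signed_add_two_eval {k i : ℕ} (d : ℕ → ℕ) (hi : i + 2 < k) (x : ℝ) :
    (-1) ^ (i + 2) * (gPoly d k (i + 2)).eval x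
      = (d (i + 2) - (x + 2)) * ((-1) ^ (i + 1) * (gPoly d k (i + 1)).eval x)
        - (d (i + 2) - 1) * ((-1) ^ i * (gPoly d k i).eval x) := by
  rw [gPoly_add_two_eval d hi]
  ring

theorem gPoly_top_eval (d : ℕ → ℕ) (m : ℕ) (x : ℝ) :
    (gPoly d (m + 2) (m + 2)).eval x
      = (x + (2 - (d (m + 2) : ℝ))) * (gPoly d (m + 2) (m + 1)).eval x
        - (d (m + 2) : ℝ) * (gPoly d (m + 2) m).eval x := by
  rw [gPoly, if_neg (lt_irrefl _), if_pos rfl]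
  simp

/-- To the left of `-2` the values `(-1) ^ n * g_n` are positive and nondecreasing in `n`. -/
theorem gPoly_signed_pos_of_le {k : ℕ} {d : ℕ → ℕ} (hd : ∀ i, 2 ≤ i → i ≤ k → 2 ≤ d i)
    {x : ℝ} (hx : x ≤ -2) (n : ℕ) (hn : n + 1 < k) :
    0 < (-1) ^ n * (gPoly d k n).eval x ∧
      (-1) ^ n * (gPoly d k n).eval x ≤ (-1) ^ (n + 1) * (gPoly d k (n + 1)).eval x := by
  induction n with
  | zero =>
    simp only [gPoly, eval_add, eval_X, eval_one]
    constructor <;> norm_num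
    linarith
  | succ n ih =>
    obtain ⟨hpos, hmono⟩ := ih (by omega)
    refine ⟨hpos.trans_le hmono, ?_⟩
    have hdn : (2 : ℝ) ≤ d (n + 2) := by exact_mod_cast hd (n + 2) (by omega) (by omega)
    rw [gPoly_signed_add_two_eval d hn]
    set u := (-1) ^ n * (gPoly d k n).eval x
    set v := (-1) ^ (n + 1) * (gPoly d k (n + 1)).eval x
    nlinarith [mul_nonneg (sub_nonneg.2 hmono) (by linarith : (0 : ℝ) ≤ d (n + 2) - 1),
      mul_nonneg (by linarith : 0 ≤ v) (by linarith : 0 ≤ -2 - x)]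

/-- Two consecutive polynomials `g_n`, `g_{n+1}` with `n + 1 < k` have no common zero. -/
theorem gPoly_no_common_root {k : ℕ} {d : ℕ → ℕ} (hd : ∀ i, 2 ≤ i → i ≤ k → 2 ≤ d i)
    (x : ℝ) (n : ℕ) (hn : n + 1 < k) (h₁ : (gPoly d k (n + 1)).eval x = 0) :
    (gPoly d k n).eval x ≠ 0 := by
  induction n with
  | zero => simp [gPoly]
  | succ n ih =>
    intro h₀
    have hdn : (2 : ℝ) ≤ d (n + 2) := by exact_mod_cast hd (n + 2) (by omega) (by omega)
    rw [gPoly_add_two_eval d hn, h₀, mul_zero, zero_sub, neg_eq_zero] at h₁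
    exact ih (by omega) h₀ ((mul_eq_zero.1 h₁).resolve_left (by linarith))

/-- Let `γ` be the smallest real zero of `g_{k-1}`.  Then `γ` is not a zero
of `g_k / (λ + 2)`, nor of any `g_l` with `1 ≤ l ≤ k - 2`. -/
theorem gPoly_smallest_zero_not_root (k : ℕ) (hk : 2 ≤ k) (d : ℕ → ℕ) (hd1 : d 1 = 1)
    (hd : ∀ i, 2 ≤ i → i ≤ k → 2 ≤ d i)
    (γ : ℝ) (hγ : IsLeast {x : ℝ | (gPoly d k (k - 1)).IsRoot x} γ) :
    (∀ q : Polynomial ℝ, gPoly d k k = (X + 2) * q → ¬ q.IsRoot γ) ∧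
      (∀ l, 1 ≤ l → l ≤ k - 2 → ¬ (gPoly d k l).IsRoot γ) := by
  obtain ⟨m, rfl⟩ : ∃ m, k = m + 2 := ⟨k - 2, by omega⟩
  obtain ⟨hγ₀, hγmin⟩ := hγ
  have hγroot : (gPoly d (m + 2) (m + 1)).eval γ = 0 := hγ₀
  refine ⟨fun q hq hqγ => ?_, fun l _ hl hlγ => ?_⟩
  · have htop := gPoly_top_eval d m γ
    rw [hq, eval_mul, hqγ.eq_zero, hγroot, mul_zero, mul_zero, zero_sub, zero_eq_neg] at htop
    have hdk : (2 : ℝ) ≤ d (m + 2) := by exact_mod_cast hd (m + 2) (by omega) le_rfl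
    exact gPoly_no_common_root hd γ m (by omega) hγroot
      ((mul_eq_zero.1 htop).resolve_left (by linarith))
  · set h : ℕ → ℝ → ℝ := fun n x => (-1) ^ n * (gPoly d (m + 2) n).eval x with hh
    have hcont : ∀ n, Continuous (h n) := fun n => by
      simp only [hh]; fun_prop
    have hleft : ∀ n ≤ m + 1, ∀ x ≤ (-2 : ℝ), 0 < h n x := by
      intro n hn x hx
      rcases n with _ | n
      · exact (gPoly_signed_pos_of_le hd hx 0 (by omega)).1
      · have := gPoly_signed_pos_of_le hd hx n (by omega)
        exact this.1.trans_le this.2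
    have hroot : ∀ n, n + 2 ≤ m + 1 → ∀ z, h (n + 1) z = 0 → 0 < h n z → h (n + 2) z < 0 := by
      intro n hn z hz hpos
      have hdn : (2 : ℝ) ≤ d (n + 2) := by exact_mod_cast hd (n + 2) (by omega) (by omega)
      have hrec : h (n + 2) z
          = (d (n + 2) - (z + 2)) * h (n + 1) z - (d (n + 2) - 1) * h n z :=
        gPoly_signed_add_two_eval d (by omega) z
      rw [hrec, hz]
      nlinarith
    have hstep := sturm_pos_of_succ_pos hcont (fun x => by simp [hh, gPoly]) hleft hroot
    have hlast : ∀ y < γ, 0 < h (m + 1) y := by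
      intro y hy
      by_contra! hle
      obtain ⟨z, hzy, hz, -⟩ := exists_first_zero (hcont (m + 1)) (hleft _ le_rfl) hle
      have hzroot : (gPoly d (m + 2) (m + 1)).IsRoot z :=
        (mul_eq_zero.1 hz).resolve_left (pow_ne_zero _ (by norm_num))
      exact (hzy.trans_lt hy).not_ge (hγmin hzroot)
    have hpos : 0 < h l γ :=
      Nat.decreasingInduction' (P := fun n => ∀ y ≤ γ, 0 < h n y)
        (fun n hn _ ih => hstep n (by omega) γ fun y hy => ih y hy.le)
        (by omega : l ≤ m) (hstep m le_rfl γ hlast) γ le_rfl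
    simp only [hh, hlγ.eq_zero, mul_zero, lt_irrefl] at hpos
end

section
/- Let T be a finite tree with at least two vertices (equivalently, with at least one edge). Then the smallest eigenvalue of the line graph L(T) is strictly greater than −2. -/
open Polynomial

/-- The characteristic polynomial `det (λ I - A(G))` of the adjacency matrix of a
finite simple graph `G`. -/
noncomputable def charPoly {V : Type*} [Fintype V] (G : SimpleGraph V) : Polynomial ℝ :=
  letI := Classical.decEq V
  letI := Classical.decRel G.Adj
  Matrix.charpoly (G.adjMatrix ℝ)

/-- The smallest eigenvalue of the (real symmetric) adjacency matrix of a
finite simple graph `G`. -/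
noncomputable def lambdaMin {V : Type*} [Fintype V] (G : SimpleGraph V) : ℝ :=
  letI := Classical.decEq V
  letI := Classical.decRel G.Adj
  sInf (spectrum ℝ (G.adjMatrix ℝ))

/-- The induced subgraph `G - v` obtained by deleting the vertex `v`. -/
def deleteVertex {V : Type*} (G : SimpleGraph V) (v : V) : SimpleGraph ↥{x : V | x ≠ v} :=
  G.induce {x : V | x ≠ v}

noncomputable instance setFintypeOfFinite {V : Type*} [Finite V] (s : Set V) : Fintype ↥s :=
  Fintype.ofFinite _

namespace SimpleGraph

open Matrix

variable {V : Type*} (G : SimpleGraph V)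

open Classical in
/-- The vertex-edge incidence matrix of `G`, with columns indexed by the edges of `G` only. -/
noncomputable def edgeIncMatrix : Matrix V G.edgeSet ℝ :=
  Matrix.of fun v e => if v ∈ (e : Sym2 V) then 1 else 0

open Classical in
theorem edgeIncMatrix_apply (v : V) (e : G.edgeSet) :
    G.edgeIncMatrix v e = if v ∈ (e : Sym2 V) then 1 else 0 := rfl

/-- The Gram matrix of the columns of the incidence matrix is `A(L(G)) + 2I`. -/
theorem transpose_edgeIncMatrix_mul_self [Fintype V] [DecidableEq G.edgeSet]
    [DecidableRel G.lineGraph.Adj] :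
    G.edgeIncMatrixᵀ * G.edgeIncMatrix = G.lineGraph.adjMatrix ℝ + (2 : ℝ) • 1 := by
  classical
  ext e f
  have hsum : (G.edgeIncMatrixᵀ * G.edgeIncMatrix) e f =
      ((Finset.univ.filter fun v => v ∈ (e : Sym2 V) ∧ v ∈ (f : Sym2 V)).card : ℝ) := by
    simp [Matrix.mul_apply, edgeIncMatrix_apply, ← ite_and, and_comm]
  rw [hsum]
  simp only [Matrix.add_apply, Matrix.smul_apply, adjMatrix_apply, Matrix.one_apply,
    lineGraph_adj_iff_exists]
  by_cases hef : e = f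
  · subst hef
    obtain ⟨e, he⟩ := e
    induction e with
    | _ a b =>
      have hab : a ≠ b := G.ne_of_adj he
      have : (Finset.univ.filter fun v => v = a ∨ v = b) = {a, b} := by
        ext v; simp
      simp [this, Finset.card_pair hab]
  · by_cases hv : ∃ v, v ∈ (e : Sym2 V) ∧ v ∈ (f : Sym2 V)
    · obtain ⟨v, hve, hvf⟩ := hv
      have : (Finset.univ.filter fun v => v ∈ (e : Sym2 V) ∧ v ∈ (f : Sym2 V)) = {v} := by
        ext u
        simp only [Finset.mem_filter, Finset.mem_univ, true_and, Finset.mem_singleton]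
        refine ⟨fun ⟨hue, huf⟩ => ?_, fun h => h ▸ ⟨hve, hvf⟩⟩
        by_contra huv
        exact hef (Subtype.ext (((Sym2.mem_and_mem_iff huv).1 ⟨hue, hve⟩).trans
          ((Sym2.mem_and_mem_iff huv).1 ⟨huf, hvf⟩).symm))
      have hex : ∃ v, v ∈ (e : Sym2 V) ∧ v ∈ (f : Sym2 V) := ⟨v, hve, hvf⟩
      simp [this, hef, hex]
    · have : (Finset.univ.filter fun v => v ∈ (e : Sym2 V) ∧ v ∈ (f : Sym2 V)) = ∅ := by
        ext u
        simpa using fun h h' => hv ⟨u, h, h'⟩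
      simp [this, hef, hv]

variable {G}

/-- A vector in the left kernel of the incidence matrix alternates in sign along edges. -/
theorem add_eq_zero_of_transpose_edgeIncMatrix_mulVec_eq_zero [Fintype V] {y : V → ℝ}
    (hy : G.edgeIncMatrixᵀ *ᵥ y = 0) {a b : V} (hab : G.Adj a b) : y a + y b = 0 := by
  classical
  have h := congrFun hy ⟨s(a, b), hab⟩
  have hs : (Finset.univ.filter fun v => v = a ∨ v = b) = {a, b} := by ext v; simp
  simpa [Matrix.mulVec, dotProduct, edgeIncMatrix_apply, ← Finset.sum_filter, hs,
    Finset.sum_pair (G.ne_of_adj hab)] using h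

theorem Connected.eq_zero_of_transpose_edgeIncMatrix_mulVec_eq_zero [Fintype V]
    (hG : G.Connected) {y : V → ℝ} (hy : G.edgeIncMatrixᵀ *ᵥ y = 0) {r : V} (hr : y r = 0) :
    y = 0 := by
  funext v
  obtain ⟨p⟩ := hG.preconnected v r
  induction p with
  | nil => exact hr
  | cons hadj _ ih =>
    have := add_eq_zero_of_transpose_edgeIncMatrix_mulVec_eq_zero hy hadj
    have := ih hr
    simp_all

/-- The transpose of the incidence matrix of a tree is surjective, by counting dimensions. -/
theorem IsTree.surjective_transpose_edgeIncMatrix_mulVec [Fintype V] [Fintype G.edgeSet]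
    (hG : G.IsTree) : Function.Surjective fun y : V → ℝ => G.edgeIncMatrixᵀ *ᵥ y := by
  classical
  obtain ⟨r⟩ := hG.connected.nonempty
  let f : (V → ℝ) →ₗ[ℝ] (G.edgeSet → ℝ) := G.edgeIncMatrixᵀ.mulVecLin
  have hker : Module.finrank ℝ (LinearMap.ker f) ≤ 1 := by
    let ev : LinearMap.ker f →ₗ[ℝ] ℝ := (LinearMap.proj r).comp (LinearMap.ker f).subtype
    have hev : Function.Injective ev := by
      rw [← LinearMap.ker_eq_bot, LinearMap.ker_eq_bot']
      intro y hy
      exact Subtype.ext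
        (hG.connected.eq_zero_of_transpose_edgeIncMatrix_mulVec_eq_zero y.2 hy)
    simpa using LinearMap.finrank_le_finrank_of_injective hev
  have hrank := f.finrank_range_add_finrank_ker
  have hcard := hG.card_edgeFinset
  rw [edgeFinset_card] at hcard
  rw [Module.finrank_fintype_fun_eq_card] at hrank
  have hle := Submodule.finrank_le (LinearMap.range f)
  rw [Module.finrank_fintype_fun_eq_card] at hle
  refine LinearMap.range_eq_top.1 (Submodule.eq_top_of_finrank_eq (S := LinearMap.range f) ?_)
  rw [Module.finrank_fintype_fun_eq_card]
  omega

theorem IsTree.eq_zero_of_edgeIncMatrix_mulVec_eq_zero [Fintype V] [Fintype G.edgeSet]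
    (hG : G.IsTree) {x : G.edgeSet → ℝ} (hx : G.edgeIncMatrix *ᵥ x = 0) : x = 0 := by
  obtain ⟨y, hy⟩ := hG.surjective_transpose_edgeIncMatrix_mulVec x
  dsimp only at hy
  rw [← dotProduct_self_eq_zero]
  nth_rewrite 2 [← hy]
  rw [dotProduct_mulVec, vecMul_transpose, hx, zero_dotProduct]

/-- Eigenvalues of the line graph of a tree are greater than `-2`. -/
theorem IsTree.neg_two_lt_of_lineGraph_adjMatrix_mulVec_eq [Fintype V] [Fintype G.edgeSet]
    [DecidableRel G.lineGraph.Adj] (hG : G.IsTree) {μ : ℝ} {x : G.edgeSet → ℝ} (hx : x ≠ 0)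
    (h : G.lineGraph.adjMatrix ℝ *ᵥ x = μ • x) : -2 < μ := by
  classical
  have hgram : (G.edgeIncMatrix *ᵥ x) ⬝ᵥ (G.edgeIncMatrix *ᵥ x) = (μ + 2) * (x ⬝ᵥ x) := by
    calc (G.edgeIncMatrix *ᵥ x) ⬝ᵥ (G.edgeIncMatrix *ᵥ x)
        = x ⬝ᵥ ((G.edgeIncMatrixᵀ * G.edgeIncMatrix) *ᵥ x) := by
          rw [← mulVec_mulVec, dotProduct_mulVec x, vecMul_transpose]
      _ = (μ + 2) * (x ⬝ᵥ x) := by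
          rw [transpose_edgeIncMatrix_mul_self, add_mulVec, h, smul_mulVec, one_mulVec,
            ← add_smul, dotProduct_smul, smul_eq_mul]
  have hxx : 0 ≤ x ⬝ᵥ x := Finset.sum_nonneg fun i _ => mul_self_nonneg (x i)
  have hNx : 0 < (G.edgeIncMatrix *ᵥ x) ⬝ᵥ (G.edgeIncMatrix *ᵥ x) :=
    lt_of_le_of_ne (Finset.sum_nonneg fun i _ => mul_self_nonneg _)
      (Ne.symm (mt dotProduct_self_eq_zero.1
        (mt hG.eq_zero_of_edgeIncMatrix_mulVec_eq_zero hx)))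
  rw [hgram] at hNx
  linarith [pos_of_mul_pos_left hNx hxx]

end SimpleGraph

/-- The smallest eigenvalue of a graph with at least one vertex is attained by an eigenvector. -/
theorem exists_adjMatrix_mulVec_eq_lambdaMin_smul {V : Type*} [Fintype V] [Nonempty V]
    (G : SimpleGraph V) [DecidableRel G.Adj] :
    ∃ x : V → ℝ, x ≠ 0 ∧ (G.adjMatrix ℝ).mulVec x = lambdaMin G • x := by
  classical
  have hA : (G.adjMatrix ℝ).IsHermitian := G.isHermitian_adjMatrix ℝ
  have hmem : lambdaMin G ∈ Set.range hA.eigenvalues := by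
    have hdef : lambdaMin G = sInf (Set.range hA.eigenvalues) := by
      rw [← hA.spectrum_real_eq_range_eigenvalues, lambdaMin]
      congr!
    rw [hdef]
    exact (Set.range_nonempty _).csInf_mem (Set.finite_range _)
  obtain ⟨i, hi⟩ := hmem
  refine ⟨hA.eigenvectorBasis i, ?_, hi ▸ hA.mulVec_eigenvectorBasis i⟩
  intro h
  exact hA.eigenvectorBasis.orthonormal.ne_zero i (by ext j; exact congrFun h j)

/-- The smallest eigenvalue of the line graph of a finite tree with at
least two vertices is strictly greater than `-2`. -/
theorem lambdaMin_lineGraph_tree {V : Type*} [Fintype V] (T : SimpleGraph V)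
    (hT : T.IsTree) (hV : 2 ≤ Fintype.card V) :
    -2 < lambdaMin (SimpleGraph.lineGraph T) := by
  classical
  have : Nontrivial V := Fintype.one_lt_card_iff_nontrivial.1 hV
  obtain ⟨v⟩ := hT.connected.nonempty
  obtain ⟨w, hvw⟩ := hT.connected.preconnected.exists_adj_of_nontrivial v
  have : Nonempty T.edgeSet := ⟨⟨s(v, w), hvw⟩⟩
  let : Fintype T.edgeSet := setFintypeOfFinite T.edgeSet
  obtain ⟨x, hx, h⟩ := exists_adjMatrix_mulVec_eq_lambdaMin_smul T.lineGraph
  exact hT.neg_two_lt_of_lineGraph_adjMatrix_mulVec_eq hx h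
end
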